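/- arXiv:2405.02205 — 2 statements merged into one kernel-verified Lean document; each statement's English description precedes it below -/
import Mathlib

section
/- Gradient of the Dirichlet energy at a vertex: let v₁, …, vₙ be points of the hyperboloid H², let c₁, …, cₙ > 0, and let c : ℝ → ℝ³ be differentiable at 0 with ⟨c(t), c(t)⟩ = −1 for all t, c(0) =: u ∈ H², and ⟨u, vⱼ⟩ < −1 for every j. Set ℓⱼ := arcosh(−⟨u, vⱼ⟩) and D(t) := ½ Σⱼ cⱼ arcosh(−⟨c(t), vⱼ⟩)². Then D is differentiable at 0 and D'(0) = −⟨ Σⱼ (cⱼ ℓⱼ / sinh ℓⱼ) (vⱼ − u), c'(0) ⟩. -/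
noncomputable section

/-- The Minkowski bilinear form on ℝ^{2,1}. -/
def mink (x y : Fin 3 → ℝ) : ℝ := x 0 * y 0 + x 1 * y 1 - x 2 * y 2

/-- The hyperboloid model of the hyperbolic plane:
`H² = {x ∈ ℝ³ : ⟨x,x⟩ = −1, x₃ > 0}`. -/
def hyperboloid (x : Fin 3 → ℝ) : Prop := mink x x = -1 ∧ x 2 > 0

/-- The inverse hyperbolic cosine `arcosh`. -/
def arcosh (x : ℝ) : ℝ := Real.log (x + Real.sqrt (x ^ 2 - 1))

/-- The local definition agrees with the Mathlib one. -/
lemma arcosh_eq_real : arcosh = Real.arcosh := by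
  funext x
  simp [arcosh, Real.arcosh]

lemma hasDerivAt_mink {a b : ℝ → Fin 3 → ℝ} {a' b' : Fin 3 → ℝ} {t : ℝ}
    (ha : HasDerivAt a a' t) (hb : HasDerivAt b b' t) :
    HasDerivAt (fun s => mink (a s) (b s)) (mink a' (b t) + mink (a t) b') t := by
  have ha := hasDerivAt_pi.1 ha
  have hb := hasDerivAt_pi.1 hb
  have h := (((ha 0).mul (hb 0)).add ((ha 1).mul (hb 1))).sub ((ha 2).mul (hb 2))
  refine h.congr_deriv ?_
  simp only [mink]
  ring

lemma mink_sum_left {n : ℕ} (f : Fin n → ℝ) (w : Fin n → Fin 3 → ℝ) (y : Fin 3 → ℝ) :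
    mink (∑ j, f j • w j) y = ∑ j, f j * mink (w j) y := by
  simp only [mink, Finset.sum_apply, Pi.smul_apply, smul_eq_mul, Finset.sum_mul,
    ← Finset.sum_add_distrib, ← Finset.sum_sub_distrib]
  refine Finset.sum_congr rfl fun j _ => ?_
  ring

/-- Gradient of the Dirichlet energy at a vertex: moving the vertex along a path `c`
on the hyperboloid with neighbours `vⱼ` and weights `cⱼ > 0`, the energy
`D(t) = ½ Σⱼ cⱼ arcosh(−⟨c(t), vⱼ⟩)²` has derivative
`D'(0) = −⟨ Σⱼ (cⱼ ℓⱼ / sinh ℓⱼ)(vⱼ − u), c'(0) ⟩` at `t = 0`. -/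
theorem dirichlet_energy_gradient_at_vertex
    (n : ℕ) (v : Fin n → Fin 3 → ℝ) (hv : ∀ j, hyperboloid (v j))
    (cw : Fin n → ℝ) (hcw : ∀ j, 0 < cw j)
    (c : ℝ → Fin 3 → ℝ) (c' : Fin 3 → ℝ) (hc : HasDerivAt c c' 0)
    (hcH : ∀ t, mink (c t) (c t) = -1)
    (u : Fin 3 → ℝ) (hu : c 0 = u) (huH : hyperboloid u)
    (hlt : ∀ j, mink u (v j) < -1) :
    HasDerivAt (fun t => (1 / 2 : ℝ) * ∑ j, cw j * (arcosh (-(mink (c t) (v j)))) ^ 2)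
      (-(mink (∑ j, (cw j * arcosh (-(mink u (v j))) /
          Real.sinh (arcosh (-(mink u (v j))))) • (v j - u)) c')) 0 := by
  subst hu
  have horth : mink (c 0) c' = 0 := by
    have h1 := hasDerivAt_mink hc hc
    have h2 : HasDerivAt (fun s => mink (c s) (c s)) 0 0 := by
      simp only [hcH]
      exact hasDerivAt_const _ _
    have h3 := h1.unique h2
    simp only [mink] at h3 ⊢
    linarith
  have key : ∀ j, HasDerivAt (fun t => cw j * (arcosh (-(mink (c t) (v j)))) ^ 2)
      (-2 * ((cw j * arcosh (-(mink (c 0) (v j))) /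
          Real.sinh (arcosh (-(mink (c 0) (v j))))) * mink (v j - c 0) c')) 0 := by
    intro j
    have hx : 1 < -(mink (c 0) (v j)) := by linarith [hlt j]
    have hm := (hasDerivAt_mink hc (hasDerivAt_const (0 : ℝ) (v j))).neg
    have ha := (Real.hasDerivAt_arcosh hx).comp (0 : ℝ) hm
    have h := (ha.pow 2).const_mul (cw j)
    rw [arcosh_eq_real, Real.sinh_arcosh hx.le]
    refine h.congr_deriv ?_
    have e1 : mink (v j - c 0) c' = mink c' (v j) := by
      simp only [mink, Pi.sub_apply] at horth ⊢
      linarith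
    have e2 : mink (c 0) (0 : Fin 3 → ℝ) = 0 := by simp [mink]
    rw [e1, e2]
    simp only [Function.comp]
    simp
    ring
  have hs := (HasDerivAt.fun_sum (u := Finset.univ) fun j _ => key j).const_mul (1 / 2 : ℝ)
  refine hs.congr_deriv ?_
  rw [mink_sum_left, ← Finset.mul_sum]
  ring
end
end

section
/- Derivative of the Dirichlet energy over a finite family of edges: let E be a finite index set, and for each e ∈ E let c_e > 0 and let f_e, g_e : ℝ → ℝ³ be differentiable at 0 with ⟨f_e(t), f_e(t)⟩ = −1 and ⟨g_e(t), g_e(t)⟩ = −1 for all t, and ⟨f_e(0), g_e(0)⟩ < −1. Set ℓ_e(t) := arcosh(−⟨f_e(t), g_e(t)⟩) and D(t) := ½ Σ_{e∈E} c_e ℓ_e(t)². Then D is differentiable at 0 and D'(0) = Σ_{e∈E} (c_e ℓ_e(0) / sinh ℓ_e(0)) ⟨ f_e(0) × g_e(0), g_e(0) × g_e'(0) − f_e(0) × f_e'(0) ⟩. -/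
noncomputable section

/-- The Minkowski cross product on ℝ^{2,1}. -/
def mcross (x y : Fin 3 → ℝ) : Fin 3 → ℝ :=
  ![x 1 * y 2 - x 2 * y 1, x 2 * y 0 - x 0 * y 2, x 1 * y 0 - x 0 * y 1]

theorem mink_comm (x y : Fin 3 → ℝ) : mink x y = mink y x := by
  simp only [mink]; ring

theorem mink_mcross (x y u v : Fin 3 → ℝ) :
    mink (mcross x y) (mcross y u - mcross x v) =
      mink x u * mink y y - mink x y * mink y u
        + mink x x * mink y v - mink x v * mink x y := by
  simp [mink, mcross]; ring

theorem mink_hasDerivAt {f g : ℝ → Fin 3 → ℝ} {f' g' : Fin 3 → ℝ}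
    (hf : HasDerivAt f f' 0) (hg : HasDerivAt g g' 0) :
    HasDerivAt (fun t => mink (f t) (g t)) (mink f' (g 0) + mink (f 0) g') 0 := by
  have F := hasDerivAt_pi.1 hf
  have G := hasDerivAt_pi.1 hg
  refine ((((F 0).mul (G 0)).add ((F 1).mul (G 1))).sub ((F 2).mul (G 2))).congr_deriv ?_
  simp only [mink]; ring

/-- Derivative of the Dirichlet energy over a finite family of edges: with endpoints
moving along paths `f_e`, `g_e` on the hyperboloid, edge lengths
`ℓ_e(t) = arcosh(−⟨f_e(t), g_e(t)⟩)` and energy `D(t) = ½ Σ_e c_e ℓ_e(t)²`, one has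
`D'(0) = Σ_e (c_e ℓ_e(0)/sinh ℓ_e(0)) ⟨f_e(0) × g_e(0), g_e(0) × g_e'(0) − f_e(0) × f_e'(0)⟩`. -/
theorem dirichlet_energy_derivative
    (E : Type*) [Fintype E]
    (c : E → ℝ) (hc : ∀ e, 0 < c e)
    (f g : E → ℝ → Fin 3 → ℝ) (f' g' : E → Fin 3 → ℝ)
    (hf : ∀ e, HasDerivAt (f e) (f' e) 0)
    (hg : ∀ e, HasDerivAt (g e) (g' e) 0)
    (hfH : ∀ e t, mink (f e t) (f e t) = -1)
    (hgH : ∀ e t, mink (g e t) (g e t) = -1)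
    (hlt : ∀ e, mink (f e 0) (g e 0) < -1) :
    HasDerivAt
      (fun t => (1 / 2 : ℝ) * ∑ e, c e * (arcosh (-(mink (f e t) (g e t)))) ^ 2)
      (∑ e, (c e * arcosh (-(mink (f e 0) (g e 0))) /
          Real.sinh (arcosh (-(mink (f e 0) (g e 0))))) *
        mink (mcross (f e 0) (g e 0))
          (mcross (g e 0) (g' e) - mcross (f e 0) (f' e))) 0 := by
  have key : ∀ e ∈ (Finset.univ : Finset E), HasDerivAt
      (fun t => c e * (arcosh (-(mink (f e t) (g e t)))) ^ 2)
      (2 * ((c e * arcosh (-(mink (f e 0) (g e 0))) /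
          Real.sinh (arcosh (-(mink (f e 0) (g e 0))))) *
        mink (mcross (f e 0) (g e 0))
          (mcross (g e 0) (g' e) - mcross (f e 0) (f' e)))) 0 := by
    intro e _
    have h1 : 1 < -(mink (f e 0) (g e 0)) := by linarith [hlt e]
    have hm := mink_hasDerivAt (hf e) (hg e)
    have hff := mink_hasDerivAt (hf e) (hf e)
    have hgg := mink_hasDerivAt (hg e) (hg e)
    simp only [hfH e] at hff
    simp only [hgH e] at hgg
    have ef := hff.unique (hasDerivAt_const (0 : ℝ) (-1 : ℝ))
    have eg := hgg.unique (hasDerivAt_const (0 : ℝ) (-1 : ℝ))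
    have ha : HasDerivAt arcosh (Real.sqrt ((-(mink (f e 0) (g e 0))) ^ 2 - 1))⁻¹
        (-(mink (f e 0) (g e 0))) := Real.hasDerivAt_arcosh h1
    have hs : Real.sinh (arcosh (-(mink (f e 0) (g e 0)))) =
        Real.sqrt ((-(mink (f e 0) (g e 0))) ^ 2 - 1) := Real.sinh_arcosh h1.le
    have hid : mink (mcross (f e 0) (g e 0))
          (mcross (g e 0) (g' e) - mcross (f e 0) (f' e)) =
          -(mink (f' e) (g e 0) + mink (f e 0) (g' e)) := by
      have a := hfH e 0
      have b := hgH e 0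
      rw [mink_mcross]
      rw [a, b]
      have ef2 : mink (f e 0) (f' e) = 0 := by
        rw [mink_comm (f' e)] at ef; linarith
      have eg2 : mink (g e 0) (g' e) = 0 := by
        rw [mink_comm (g' e)] at eg; linarith
      rw [ef2, eg2, mink_comm (f' e)]
      ring
    have h := ((ha.comp (0 : ℝ) hm.neg).pow 2).const_mul (c e)
    rw [hid, hs]
    refine h.congr_deriv ?_
    simp only [Function.comp]
    norm_num
    ring
  have h := (HasDerivAt.fun_sum key).const_mul (1 / 2 : ℝ)
  refine h.congr_deriv ?_
  rw [← Finset.mul_sum]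
  ring
end
end
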